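/- Assume the sequence (τ_t)_{t≥0} is nonincreasing, assume C_s > 2 d_Ψ d_𝒞 / μ_ for every s ≥ 0, and choose T ≥ 0 such that 1 − (4 n μ̄ d_η / μ_) τ_T > 0. Then for every t ≥ 0, C_t ≤ max{ C_0 · Π_{k=0}^{T} (1 − τ_k)^{−1}, 64 n² μ̄² d_η² / ( μ_³ (1 − (4 n μ̄ d_η / μ_) τ_T) ) }. -/

import Mathlib

noncomputable section

/-- The spectral norm (largest singular value) of a real square matrix. -/
def specNorm {p : ℕ} (M : Matrix (Fin p) (Fin p) ℝ) : ℝ :=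
  ‖(Matrix.toEuclideanCLM (𝕜 := ℝ) M :
      EuclideanSpace ℝ (Fin p) →L[ℝ] EuclideanSpace ℝ (Fin p))‖

open scoped MatrixOrder in
/-- The trace of `M * V` with `V` positive semidefinite is a sum of values of the quadratic form of
`M` at vectors whose squared lengths add up to the trace of `V`. -/
lemma Matrix.PosSemidef.exists_trace_mul_eq_sum {p : ℕ} {V : Matrix (Fin p) (Fin p) ℝ}
    (hV : V.PosSemidef) :
    ∃ B : Matrix (Fin p) (Fin p) ℝ, V.trace = ∑ i, B i ⬝ᵥ B i ∧
      ∀ M : Matrix (Fin p) (Fin p) ℝ, (M * V).trace = ∑ i, B i ⬝ᵥ M.mulVec (B i) := by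
  obtain ⟨B, hB⟩ := CStarAlgebra.nonneg_iff_eq_star_mul_self.mp hV.nonneg
  have key : ∀ M : Matrix (Fin p) (Fin p) ℝ, (M * V).trace = ∑ i, B i ⬝ᵥ M.mulVec (B i) := by
    intro M
    rw [hB, Matrix.star_eq_conjTranspose, ← Matrix.mul_assoc, Matrix.trace_mul_comm]
    refine Finset.sum_congr rfl fun i _ => ?_
    rw [Matrix.diag_apply, Matrix.mul_apply']
    congr 1
  refine ⟨B, ?_, key⟩
  simpa using key 1

lemma Matrix.PosSemidef.trace_mul_nonneg {p : ℕ} {A V : Matrix (Fin p) (Fin p) ℝ}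
    (hA : A.PosSemidef) (hV : V.PosSemidef) : 0 ≤ (A * V).trace := by
  obtain ⟨B, -, hB⟩ := hV.exists_trace_mul_eq_sum
  rw [hB]
  exact Finset.sum_nonneg fun i _ => by simpa using hA.dotProduct_mulVec_nonneg (B i)

lemma specNorm_nonneg {p : ℕ} (M : Matrix (Fin p) (Fin p) ℝ) : 0 ≤ specNorm M :=
  norm_nonneg _

lemma abs_dotProduct_mulVec_le_specNorm_mul {p : ℕ} (M : Matrix (Fin p) (Fin p) ℝ)
    (x : Fin p → ℝ) : |x ⬝ᵥ M.mulVec x| ≤ specNorm M * (x ⬝ᵥ x) := by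
  set y : EuclideanSpace ℝ (Fin p) := WithLp.toLp 2 x
  have hxx : x ⬝ᵥ x = ‖y‖ * ‖y‖ := by
    have h := Matrix.inner_toEuclideanCLM (1 : Matrix (Fin p) (Fin p) ℝ) y y
    simpa [y, pow_two] using h.symm
  have h := Matrix.inner_toEuclideanCLM M y y
  rw [show x ⬝ᵥ M.mulVec x = _ from h.symm, hxx]
  refine (abs_real_inner_le_norm _ _).trans ?_
  have h' := (Matrix.toEuclideanCLM (𝕜 := ℝ) M).le_opNorm y
  calc ‖y‖ * ‖Matrix.toEuclideanCLM (𝕜 := ℝ) M y‖ ≤ ‖y‖ * (specNorm M * ‖y‖) :=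
        mul_le_mul_of_nonneg_left h' (norm_nonneg _)
    _ = specNorm M * (‖y‖ * ‖y‖) := by ring

lemma Matrix.PosSemidef.abs_trace_mul_le {p : ℕ} {V : Matrix (Fin p) (Fin p) ℝ}
    (hV : V.PosSemidef) (M : Matrix (Fin p) (Fin p) ℝ) :
    |(M * V).trace| ≤ specNorm M * V.trace := by
  obtain ⟨B, hB, hM⟩ := hV.exists_trace_mul_eq_sum
  rw [hM, hB, Finset.mul_sum]
  exact (Finset.abs_sum_le_sum_abs _ _).trans
    (Finset.sum_le_sum fun i _ => abs_dotProduct_mulVec_le_specNorm_mul M (B i))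

lemma div_convexComb_le {η a v τ : ℝ} (hη : 0 ≤ η) (ha : 0 < a) (hv : 0 ≤ v) (hτ0 : 0 ≤ τ)
    (hτ1 : τ < 1) : η / ((1 - τ) * a + τ * v) ≤ η / a * (1 - τ)⁻¹ := by
  have h1 : 0 < 1 - τ := sub_pos.mpr hτ1
  rw [← div_eq_mul_inv, div_div]
  apply div_le_div_of_nonneg_left hη (by positivity)
  nlinarith [mul_nonneg hτ0 hv]

lemma sum_div_convexComb_le {ι : Type*} {s : Finset ι} {η a v : ι → ℝ} {τ : ℝ}
    (hη : ∀ i, 0 ≤ η i) (ha : ∀ i, 0 < a i) (hv : ∀ i, 0 ≤ v i) (hτ0 : 0 ≤ τ) (hτ1 : τ < 1) :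
    ∑ i ∈ s, η i / ((1 - τ) * a i + τ * v i) ≤ (∑ i ∈ s, η i / a i) * (1 - τ)⁻¹ := by
  rw [Finset.sum_mul]
  exact Finset.sum_le_sum fun i _ => div_convexComb_le (hη i) (ha i) (hv i) hτ0 hτ1

/-- Once `∑ η i / a i` is large, moving `a` a short step towards `v` does not increase it. -/
lemma sum_div_convexComb_le_self {n : ℕ} (hn : 1 ≤ n) {η a v : Fin n → ℝ} {τ D M m : ℝ}
    (hη : ∀ i, 0 ≤ η i) (hηD : ∀ i, η i ≤ D) (ha : ∀ i, 0 < a i) (hv : ∀ i, 0 ≤ v i)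
    (hvM : ∀ i, v i ≤ M) (hτ0 : 0 < τ) (hτ1 : τ < 1) (hm : 0 < m) (hM : 0 < M) (hD : 0 < D)
    (hτ : 4 * n * M * τ ≤ m)
    (hsum : m * (∑ i, η i / a i) / 2 ≤ ∑ i, η i / a i * v i)
    (hlarge : 8 * n ^ 2 * M * D / m ^ 2 ≤ ∑ i, η i / a i) :
    ∑ i, η i / ((1 - τ) * a i + τ * v i) ≤ ∑ i, η i / a i := by
  set C := ∑ i, η i / a i with hC
  have hn0 : (0 : ℝ) < n := by exact_mod_cast hn
  have hC0 : 0 < C := lt_of_lt_of_le (by positivity) hlarge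
  have : Nonempty (Fin n) := ⟨⟨0, hn⟩⟩
  obtain ⟨j, -, hj⟩ : ∃ j ∈ Finset.univ, m * C / (2 * n) ≤ η j / a j * v j := by
    apply Finset.exists_le_of_sum_le Finset.univ_nonempty
    refine le_trans (le_of_eq ?_) hsum
    simp
    field_simp
  have h1 : 0 < 1 - τ := sub_pos.mpr hτ1
  set w := η j / a j with hw
  have hηj : η j = w * a j := by rw [hw, div_mul_cancel₀ _ (ha j).ne']
  have hw0 : 0 ≤ w := div_nonneg (hη j) (ha j).le
  have hwM : m * C / (2 * n) ≤ w * M := hj.trans (mul_le_mul_of_nonneg_left (hvM j) hw0)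
  have hwτ : m * C / (4 * n * M) ≤ w - τ * C := by
    have hA : m * C / (2 * n * M) ≤ w := by
      rw [← div_div, div_le_iff₀ hM]; exact hwM
    have hB : τ * C ≤ m * C / (4 * n * M) := by
      rw [le_div_iff₀ (by positivity)]; nlinarith
    have : m * C / (2 * n * M) = m * C / (4 * n * M) + m * C / (4 * n * M) := by
      field_simp; norm_num
    linarith
  have hwpos : 0 < w := by
    have : 0 < m * C / (4 * n * M) := by positivity
    nlinarith [mul_pos hτ0 hC0]
  have hprod : C * η j ≤ (w - τ * C) * (w * v j) := by
    have h2 : (m * C / (4 * n * M)) * (m * C / (2 * n)) ≤ (w - τ * C) * (w * v j) :=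
      mul_le_mul hwτ hj (by positivity) (le_trans (by positivity) hwτ)
    refine le_trans ?_ h2
    have h3 : C * η j ≤ C * D := mul_le_mul_of_nonneg_left (hηD j) hC0.le
    refine h3.trans ?_
    rw [div_le_iff₀ (by positivity)] at hlarge
    rw [div_mul_div_comm, le_div_iff₀ (by positivity)]
    nlinarith
  have hcore : (1 - τ) * (C * a j) ≤ (w - τ * C) * v j := by
    have : w * (C * a j) ≤ w * ((w - τ * C) * v j) := by
      calc w * (C * a j) = C * η j := by rw [hηj]; ring
        _ ≤ _ := hprod
        _ = _ := by ring
    have h4 := le_of_mul_le_mul_left this hwpos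
    have : 0 < C * a j := mul_pos hC0 (ha j)
    nlinarith
  have hterm : η j / ((1 - τ) * a j + τ * v j) ≤ (w - τ * C) * (1 - τ)⁻¹ := by
    have : 0 < (1 - τ) * a j + τ * v j :=
      add_pos_of_pos_of_nonneg (mul_pos h1 (ha j)) (mul_nonneg hτ0.le (hv j))
    rw [← div_eq_mul_inv, div_le_div_iff₀ this h1, hηj]
    nlinarith
  have hrest := sum_div_convexComb_le (s := Finset.univ.erase j) hη ha hv hτ0.le hτ1
  have hCsplit : w + ∑ i ∈ Finset.univ.erase j, η i / a i = C :=
    Finset.add_sum_erase _ (fun i => η i / a i) (Finset.mem_univ j)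
  rw [← Finset.add_sum_erase _ _ (Finset.mem_univ j)]
  calc _ ≤ (w - τ * C) * (1 - τ)⁻¹ + (C - w) * (1 - τ)⁻¹ := by
        rw [← hCsplit] at hterm ⊢; rw [add_sub_cancel_left]; exact add_le_add hterm hrest
    _ = C := by field_simp; ring

/-- Uniform bound on `C_t` when `C_s > 2 d_Ψ d_𝒞/μ_` for all `s`:
`C_t ≤ max{C_0 ∏_{k≤T}(1-τ_k)⁻¹, 64 n² μ̄² d_η²/(μ_³(1-(4 n μ̄ d_η/μ_)τ_T))}`. -/
theorem frankWolfe_uniform_bound_aux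
    (p n : ℕ) (hp : 1 ≤ p) (hn : 1 ≤ n) (c : ℝ) (hc : 0 < c)
    (Ψ : Matrix (Fin p) (Fin p) ℝ) (η : Fin n → ℕ)
    (Φ : Fin n → Matrix (Fin p) (Fin p) ℝ) (hΦ : ∀ i, (Φ i).PosSemidef)
    (α : ℕ → ℝ) (hα : ∀ t, 0 ≤ α t) (hα0 : 0 < α 0)
    (S : ℕ → ℝ) (hS : ∀ t, S t = ∑ k ∈ Finset.range (t + 1), α k)
    (τ : ℕ → ℝ) (hτ : ∀ t, τ t = α (t + 1) / S (t + 1))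
    (hτ01 : ∀ t, 0 < τ t ∧ τ t < 1)
    (G : Matrix (Fin p) (Fin p) ℝ → Matrix (Fin p) (Fin p) ℝ)
    (hG : ∀ Y, G Y = Ψ - ∑ i, ((η i : ℝ) / (((Φ i) * Y).trace)) • Φ i)
    (X V : ℕ → Matrix (Fin p) (Fin p) ℝ)
    (hX0 : (X 0).PosSemidef ∧ (X 0).trace ≤ c)
    (hX0pos : ∀ i, 0 < ((Φ i) * (X 0)).trace)
    (hV : ∀ t, (V t).PosSemidef ∧ (V t).trace ≤ c)
    (hVmin : ∀ (t : ℕ) (W : Matrix (Fin p) (Fin p) ℝ), W.PosSemidef → W.trace ≤ c →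
      ((G (X t)) * (V t)).trace ≤ ((G (X t)) * W).trace)
    (hXsucc : ∀ t, X (t + 1) = (1 - τ t) • X t + τ t • V t)
    (C : ℕ → ℝ) (hC : ∀ t, C t = ∑ i, (η i : ℝ) / (((Φ i) * (X t)).trace))
    (dC dΦ dΨ dη μbar μlow : ℝ)
    (hdC : dC = 2 * c) (hdΦ : dΦ = ⨆ i, specNorm (Φ i)) (hdΨ : dΨ = specNorm Ψ)
    (hdη : dη = ⨆ i, (η i : ℝ))
    (hμbar : IsGreatest {v : ℝ | ∃ (i : Fin n) (Y : Matrix (Fin p) (Fin p) ℝ),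
      Y.PosSemidef ∧ Y.trace ≤ c ∧ v = ((Φ i) * Y).trace} μbar)
    (hμlow : μlow = ⨅ i, ((Φ i) * (X 0)).trace)
    (hτmono : Antitone τ)
    (hCall : ∀ s : ℕ, C s > 2 * dΨ * dC / μlow)
    (T : ℕ) (hT : 0 < 1 - (4 * (n : ℝ) * μbar * dη / μlow) * τ T) :
    ∀ t : ℕ,
      C t ≤ max (C 0 * ∏ k ∈ Finset.range (T + 1), (1 - τ k)⁻¹)
        (64 * (n : ℝ) ^ 2 * μbar ^ 2 * dη ^ 2 /
          (μlow ^ 3 * (1 - (4 * (n : ℝ) * μbar * dη / μlow) * τ T))) := by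
  have hn0 : (0 : ℝ) < n := by exact_mod_cast hn
  have : Nonempty (Fin n) := ⟨⟨0, hn⟩⟩
  have hηnn : ∀ i, (0 : ℝ) ≤ η i := fun i => Nat.cast_nonneg _
  have hηD : ∀ i, (η i : ℝ) ≤ dη := fun i => by
    rw [hdη]; exact le_ciSup (f := fun i => (η i : ℝ)) (Set.finite_range _).bddAbove i
  have hlow : ∀ i, μlow ≤ (Φ i * X 0).trace := fun i => by
    rw [hμlow]
    exact ciInf_le (f := fun i => (Φ i * X 0).trace) (Set.finite_range _).bddBelow i
  have hm : 0 < μlow := by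
    obtain ⟨i, hi⟩ := exists_eq_ciInf_of_finite (f := fun i => (Φ i * X 0).trace)
    rw [hμlow, ← hi]
    exact hX0pos i
  have hbar : ∀ i Y, Y.PosSemidef → Y.trace ≤ c → (Φ i * Y).trace ≤ μbar :=
    fun i Y hY hYc => hμbar.2 ⟨i, Y, hY, hYc, rfl⟩
  have hlowbar : μlow ≤ μbar :=
    (hlow ⟨0, hn⟩).trans (hbar _ _ hX0.1 hX0.2)
  have hM : 0 < μbar := hm.trans_le hlowbar
  have hΨ0 : 0 ≤ dΨ := hdΨ ▸ specNorm_nonneg Ψ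
  have hthr : 0 ≤ 2 * dΨ * dC / μlow := by rw [hdC]; positivity
  have hCpos : ∀ t, 0 < C t := fun t => hthr.trans_lt (hCall t)
  have hD : 1 ≤ dη := by
    have : ∃ i, 1 ≤ η i := by
      by_contra! h
      have h0 := hCpos 0
      rw [hC] at h0
      simp [fun i => Nat.lt_one_iff.mp (h i)] at h0
    obtain ⟨i, hi⟩ := this
    exact le_trans (by exact_mod_cast hi) (hηD i)
  have hv : ∀ t i, 0 ≤ (Φ i * V t).trace := fun t i => (hΦ i).trace_mul_nonneg (hV t).1
  have hnext : ∀ t i, (Φ i * X (t + 1)).trace =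
      (1 - τ t) * (Φ i * X t).trace + τ t * (Φ i * V t).trace := fun t i => by
    simp [hXsucc, Matrix.mul_add]
  have ha : ∀ t i, 0 < (Φ i * X t).trace := fun t => by
    induction t with
    | zero => exact hX0pos
    | succ t ih =>
      intro i
      rw [hnext]
      exact add_pos_of_pos_of_nonneg (mul_pos (sub_pos.mpr (hτ01 t).2) (ih i))
        (mul_nonneg (hτ01 t).1.le (hv t i))
  have hCsucc : ∀ t, C (t + 1) = ∑ i, (η i : ℝ) /
      ((1 - τ t) * (Φ i * X t).trace + τ t * (Φ i * V t).trace) := fun t => by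
    rw [hC]
    simp_rw [hnext]
  have hgrow : ∀ t, C (t + 1) ≤ C t * (1 - τ t)⁻¹ := fun t => by
    rw [hCsucc, hC]
    exact sum_div_convexComb_le hηnn (ha t) (hv t) (hτ01 t).1.le (hτ01 t).2
  have hGtrace : ∀ t (W : Matrix (Fin p) (Fin p) ℝ), (G (X t) * W).trace =
      (Ψ * W).trace - ∑ i, (η i : ℝ) / (Φ i * X t).trace * (Φ i * W).trace := fun t W => by
    simp [hG, Matrix.sub_mul, Matrix.sum_mul, Matrix.trace_sum]
  have hsum : ∀ t, μlow * (∑ i, (η i : ℝ) / (Φ i * X t).trace) / 2 ≤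
      ∑ i, (η i : ℝ) / (Φ i * X t).trace * (Φ i * V t).trace := fun t => by
    have hmin := hVmin t (X 0) hX0.1 hX0.2
    rw [hGtrace, hGtrace] at hmin
    have h0 : μlow * (∑ i, (η i : ℝ) / (Φ i * X t).trace) ≤
        ∑ i, (η i : ℝ) / (Φ i * X t).trace * (Φ i * X 0).trace := by
      rw [mul_comm, Finset.sum_mul]
      exact Finset.sum_le_sum fun i _ =>
        mul_le_mul_of_nonneg_left (hlow i) (div_nonneg (hηnn i) (ha t i).le)
    have hbd : ∀ Y : Matrix (Fin p) (Fin p) ℝ, Y.PosSemidef → Y.trace ≤ c →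
        |(Ψ * Y).trace| ≤ dΨ * c := fun Y hY hYc => by
      refine (hY.abs_trace_mul_le Ψ).trans ?_
      rw [← hdΨ]
      exact mul_le_mul_of_nonneg_left hYc hΨ0
    have hb0 := abs_le.mp (hbd _ hX0.1 hX0.2)
    have hb1 := abs_le.mp (hbd _ (hV t).1 (hV t).2)
    have hCt := hCall t
    rw [gt_iff_lt, div_lt_iff₀ hm, hdC, hC] at hCt
    linarith
  have hn1 : (1 : ℝ) ≤ n := by exact_mod_cast hn
  have hrateT : 4 * (n : ℝ) * μbar * dη * τ T < μlow := by
    rw [sub_pos, div_mul_eq_mul_div, div_lt_one hm] at hT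
    exact hT
  have hrate : ∀ t, T ≤ t → 4 * (n : ℝ) * μbar * τ t ≤ μlow := fun t ht => by
    have hpos : 0 ≤ 4 * (n : ℝ) * μbar * τ T :=
      mul_nonneg (by positivity) (hτ01 T).1.le
    have h1 : 4 * (n : ℝ) * μbar * τ t ≤ 4 * (n : ℝ) * μbar * τ T :=
      mul_le_mul_of_nonneg_left (hτmono ht) (by positivity)
    nlinarith
  set K := 8 * (n : ℝ) ^ 2 * μbar * dη / μlow ^ 2 with hK
  have hstep : ∀ t, T ≤ t → K ≤ C t → C (t + 1) ≤ C t := fun t ht hKt => by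
    rw [hC t] at hKt ⊢
    rw [hCsucc]
    exact sum_div_convexComb_le_self hn hηnn hηD (ha t) (hv t)
      (fun i => hbar i _ (hV t).1 (hV t).2) (hτ01 t).1 (hτ01 t).2 hm hM (by linarith)
      (hrate t ht) (hsum t) hKt
  have hhalf : ∀ t, T ≤ t → (1 - τ t)⁻¹ ≤ 2 := fun t ht => by
    have h1 := hrate t ht
    have h2 : μbar * τ t ≤ n * (μbar * τ t) :=
      le_mul_of_one_le_left (mul_nonneg hM.le (hτ01 t).1.le) hn1
    have h3 : τ t ≤ 1 / 2 := by
      by_contra! h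
      nlinarith
    rw [inv_le_comm₀ (by linarith) two_pos]
    linarith
  set δ := 1 - (4 * (n : ℝ) * μbar * dη / μlow) * τ T with hδ
  have hδ1 : δ ≤ 1 := by
    have : 0 ≤ (4 * (n : ℝ) * μbar * dη / μlow) * τ T :=
      mul_nonneg (by positivity) (hτ01 T).1.le
    linarith
  have hK2 : K * 2 ≤ 64 * (n : ℝ) ^ 2 * μbar ^ 2 * dη ^ 2 / (μlow ^ 3 * δ) := by
    have h1 : μlow * δ ≤ μbar * dη :=
      mul_le_mul hlowbar (hδ1.trans hD) hT.le hM.le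
    rw [hK, div_mul_eq_mul_div, div_le_div_iff₀ (by positivity) (by positivity)]
    calc 8 * (n : ℝ) ^ 2 * μbar * dη * 2 * (μlow ^ 3 * δ)
        = 16 * (n : ℝ) ^ 2 * μbar * dη * μlow ^ 2 * (μlow * δ) := by ring
      _ ≤ 64 * (n : ℝ) ^ 2 * μbar * dη * μlow ^ 2 * (μbar * dη) := by
        gcongr
        norm_num
      _ = _ := by ring
  have hinv1 : ∀ k, 1 ≤ (1 - τ k)⁻¹ := fun k =>
    (one_le_inv₀ (sub_pos.mpr (hτ01 k).2)).mpr (by linarith [(hτ01 k).1])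
  have hprod : ∀ t, C t ≤ C 0 * ∏ k ∈ Finset.range t, (1 - τ k)⁻¹ := fun t => by
    induction t with
    | zero => simp
    | succ t ih =>
      rw [Finset.prod_range_succ, ← mul_assoc]
      exact (hgrow t).trans (mul_le_mul_of_nonneg_right ih (zero_le_one.trans (hinv1 t)))
  have hearly : ∀ t, t ≤ T → C t ≤ C 0 * ∏ k ∈ Finset.range (T + 1), (1 - τ k)⁻¹ :=
    fun t ht => (hprod t).trans <| mul_le_mul_of_nonneg_left
      (Finset.prod_le_prod_of_subset_of_one_le (Finset.range_subset_range.mpr (by omega))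
        (fun k _ => zero_le_one.trans (hinv1 k)) (fun k _ _ => hinv1 k)) (hCpos 0).le
  intro t
  rcases le_total t T with ht | ht
  · exact (hearly t ht).trans (le_max_left _ _)
  induction t, ht using Nat.le_induction with
  | base => exact (hearly T le_rfl).trans (le_max_left _ _)
  | succ t ht ih =>
    rcases le_total K (C t) with h | h
    · exact (hstep t ht h).trans ih
    · refine le_trans ?_ (le_max_right _ _)
      exact (hgrow t).trans <| (mul_le_mul h (hhalf t ht) (zero_le_one.trans (hinv1 t))
        ((hCpos t).le.trans h)).trans hK2
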